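/- Let G be a connected subcubic graph with no two vertex-disjoint triangles. Then one of the following holds: (1) G ∈ {K_3, K_4, K_4^+} ∪ F_{2,2}; (2) r_4(G) = 4/9 and G is obtained from a disjoint union of one copy of K_4^+ and at least one copy of L by adding edges each of which is a cut-edge of G; (3) r_4(G) = 1/3 and either (a) G is obtained from a disjoint union of one copy of K_4^+, one graph in F_{3,2} ∪ F_{4,0}, and copies of L by adding edges each of which is a cut-edge of G, or (b) G is obtained from a disjoint union of one K_3 and at least one copy of L by adding edges each of which is a cut-edge of G; (4) r_4(G) = 2/9 and either (a) some block of G is isomorphic to K_4^+ or K_3, or (b) G is obtained from a disjoint union of copies of graphs in F_{3,1} by adding edges each of which is a cut-edge of G; (5) r_4(G) = 1/9 and either (a) some block of G is isomorphic to K_4^+ or K_3, or (b) G can be obtained from one graph in F_{3,2} ∪ F_{4,0} ∪ ⋃_{k≥1} F^4_{3,0,k} together with copies of members of F_{3,1} by adding edges each of which is a cut-edge of G; (6) r_4(G) ≤ 0. -/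

import Mathlib

open SimpleGraph

namespace InducedForest

/-- A graph is subcubic if every vertex has at most 3 neighbours. -/
def Subcubic {V : Type} (G : SimpleGraph V) : Prop := ∀ v : V, (G.neighborSet v).ncard ≤ 3

/-- A graph is cubic if every vertex has exactly 3 neighbours. -/
def Cubic {V : Type} (G : SimpleGraph V) : Prop := ∀ v : V, (G.neighborSet v).ncard = 3

/-- `S` is a feedback vertex set of `G` iff `G - S` is a forest. -/
def IsFVS {V : Type} (G : SimpleGraph V) (S : Set V) : Prop := (G.induce Sᶜ).IsAcyclic

/-- `φ(G)`: the minimum size of a feedback vertex set of `G`. -/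
noncomputable def fvs {V : Type} (G : SimpleGraph V) : ℕ :=
  sInf {n : ℕ | ∃ S : Set V, IsFVS G S ∧ S.ncard = n}

/-- `a(G)`: the maximum number of vertices of an induced forest in `G`. -/
noncomputable def indForestNum {V : Type} (G : SimpleGraph V) : ℕ :=
  sSup {n : ℕ | ∃ S : Set V, (G.induce S).IsAcyclic ∧ S.ncard = n}

/-- `v` is a cut-vertex of `G`: deleting it increases the number of connected components. -/
def IsCutVertex {V : Type} (G : SimpleGraph V) (v : V) : Prop :=
  Nat.card G.ConnectedComponent < Nat.card (G.induce {u | u ≠ v}).ConnectedComponent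

/-- `B` is a block of `G`: a maximal set of vertices inducing a connected subgraph
without cut-vertices. -/
def IsBlock {V : Type} (G : SimpleGraph V) (B : Set V) : Prop :=
  ((G.induce B).Connected ∧ ∀ v, ¬ IsCutVertex (G.induce B) v) ∧
  ∀ B' : Set V, B ⊆ B' →
    ((G.induce B').Connected ∧ ∀ v, ¬ IsCutVertex (G.induce B') v) → B' = B

/-- 2-connectedness: at least 3 vertices and removing fewer than 2 vertices
leaves a connected graph. -/
def TwoConnected {V : Type} (G : SimpleGraph V) : Prop :=
  3 ≤ Nat.card V ∧ ∀ s : Set V, s.ncard < 2 → (G.induce sᶜ).Connected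

/-- 3-connectedness: at least 4 vertices and removing fewer than 3 vertices
leaves a connected graph. -/
def ThreeConnected {V : Type} (G : SimpleGraph V) : Prop :=
  4 ≤ Nat.card V ∧ ∀ s : Set V, s.ncard < 3 → (G.induce sᶜ).Connected

/-- The graph obtained from `H` by subdividing the edge `xy` once;
the subdivision vertex is `none`. -/
def subdivide {V : Type} (H : SimpleGraph V) (x y : V) : SimpleGraph (Option V) :=
  SimpleGraph.fromRel (fun p q =>
    match p, q with
    | some u, some v => H.Adj u v ∧ s(u, v) ≠ s(x, y)
    | some u, none => u = x ∨ u = y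
    | _, _ => False)

/-- `G` is obtained from `H` by subdividing one edge once. -/
def IsSubdivisionOfOneEdge {V W : Type} (H : SimpleGraph V) (G : SimpleGraph W) : Prop :=
  ∃ x y : V, H.Adj x y ∧ Nonempty (G ≃g subdivide H x y)

/-- The graph obtained from `K` by adding one new vertex (`none`)
joined to all vertices of `S`. -/
def addApex {V : Type} (K : SimpleGraph V) (S : Set V) : SimpleGraph (Option V) :=
  SimpleGraph.fromRel (fun p q =>
    match p, q with
    | some u, some v => K.Adj u v
    | some u, none => u ∈ S
    | _, _ => False)

/-- `G` is (isomorphic to) `H ∘ (e1, e2, a)`: subdivide `e1` and `e2` once each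
(with `e1` subdivided twice if `e1 = e2`) and add a new vertex adjacent to `a` and to the
two subdivision vertices. -/
def IsCircOp {V W : Type} (H : SimpleGraph V) (e1 e2 : Sym2 V) (a : V)
    (G : SimpleGraph W) : Prop :=
  (e1 ≠ e2 ∧ ∃ x1 y1 x2 y2 : V, e1 = s(x1, y1) ∧ e2 = s(x2, y2) ∧
    Nonempty (G ≃g addApex (subdivide (subdivide H x1 y1) (some x2) (some y2))
      {some (some a), some none, none})) ∨
  (e1 = e2 ∧ ∃ x y : V, e1 = s(x, y) ∧
    Nonempty (G ≃g addApex (subdivide (subdivide H x y) none (some y))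
      {some (some a), some none, none}))

/-- The cycle of length `n` (for `n ≥ 3`). -/
def cyc (n : ℕ) : SimpleGraph (ZMod n) :=
  SimpleGraph.fromRel (fun u v => v = u + 1)

/-- The families `F_{i,j}` of graphs (closed under isomorphism):
`F_{i,0} = {C_i}` for `i ≥ 3`; `F_{1,1} = {K_4}`; `F_{j,j}` for `j ≥ 2` is obtained from
`F_{j-1,j-1}` by subdividing one edge once and then applying the `∘` operation at the
subdivision vertex; and `F_{i,j}` for `i > j ≥ 1` is obtained from `F_{j,j}` by `i - j`
successive single-edge subdivisions. -/
inductive MemF : ℕ → ℕ → ∀ {V : Type}, SimpleGraph V → Prop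
  | cycle {i : ℕ} (hi : 3 ≤ i) {V : Type} {G : SimpleGraph V}
      (h : Nonempty (G ≃g cyc i)) : MemF i 0 G
  | k4 {V : Type} {G : SimpleGraph V}
      (h : Nonempty (G ≃g (⊤ : SimpleGraph (Fin 4)))) : MemF 1 1 G
  | circ {j : ℕ} (hj : 2 ≤ j) {V : Type} {H : SimpleGraph V}
      (hH : MemF (j - 1) (j - 1) H) {x y : V} (hxy : H.Adj x y)
      {e1 e2 : Sym2 (Option V)} (he1 : e1 ∈ (subdivide H x y).edgeSet)
      (he2 : e2 ∈ (subdivide H x y).edgeSet)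
      {W : Type} {G : SimpleGraph W}
      (hG : IsCircOp (subdivide H x y) e1 e2 none G) : MemF j j G
  | subd {i j : ℕ} (hj : 1 ≤ j) {V : Type} {H : SimpleGraph V}
      (hH : MemF i j H) {x y : V} (hxy : H.Adj x y) {W : Type} {G : SimpleGraph W}
      (hG : Nonempty (G ≃g subdivide H x y)) : MemF (i + 1) j G

/-- `K_4^+`: the graph obtained from `K_4` by subdividing one edge once. -/
def K4plus : SimpleGraph (Option (Fin 4)) :=
  subdivide (⊤ : SimpleGraph (Fin 4)) 0 1

/-- `L`: the graph obtained from `K_4` by subdividing once each edge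
of a perfect matching. -/
def Lgraph : SimpleGraph (Option (Option (Fin 4))) :=
  subdivide (subdivide (⊤ : SimpleGraph (Fin 4)) 0 1) (some 2) (some 3)

/-- The Petersen graph. -/
def petersen : SimpleGraph (ZMod 5 × Fin 2) :=
  SimpleGraph.fromRel (fun u v =>
    (u.2 = 0 ∧ v.2 = 0 ∧ v.1 = u.1 + 1) ∨
    (u.2 = 1 ∧ v.2 = 1 ∧ v.1 = u.1 + 2) ∨
    (u.2 = 0 ∧ v.2 = 1 ∧ u.1 = v.1))

/-- `R`: the Petersen graph minus one edge. -/
def Rgraph : SimpleGraph (ZMod 5 × Fin 2) :=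
  petersen.deleteEdges {s(((0 : ZMod 5), (0 : Fin 2)), ((1 : ZMod 5), (0 : Fin 2)))}

/-- `Q_3`: the 3-dimensional cube graph. -/
def Q3 : SimpleGraph (Fin 2 × Fin 2 × Fin 2) :=
  SimpleGraph.fromRel (fun u v =>
    (u.1 ≠ v.1 ∧ u.2 = v.2) ∨ (u.1 = v.1 ∧ u.2.1 ≠ v.2.1 ∧ u.2.2 = v.2.2) ∨
    (u.1 = v.1 ∧ u.2.1 = v.2.1 ∧ u.2.2 ≠ v.2.2))

/-- `V_8`: the Wagner graph. -/
def V8 : SimpleGraph (ZMod 8) :=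
  SimpleGraph.fromRel (fun u v => v = u + 1 ∨ v = u + 4)

/-- The dodecahedron, presented as the generalized Petersen graph `GP(10,2)`. -/
def dodecahedron : SimpleGraph (ZMod 10 × Fin 2) :=
  SimpleGraph.fromRel (fun u v =>
    (u.2 = 0 ∧ v.2 = 0 ∧ v.1 = u.1 + 1) ∨
    (u.2 = 1 ∧ v.2 = 1 ∧ v.1 = u.1 + 2) ∨
    (u.2 = 0 ∧ v.2 = 1 ∧ u.1 = v.1))

/-- The families `F^g_{i,j,k}`: 2-connected subcubic graphs obtained from the disjoint
union of `k` copies of `L` (when `g = 4`) or of `R` (when `g = 5`) and one member of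
`F_{i,j}` by adding `k+1` edges; when `k ≥ 1`, each added edge joins two different
constituent copies. -/
def MemFG (g i j k : ℕ) {W : Type} (G : SimpleGraph W) : Prop :=
  TwoConnected G ∧ Subcubic G ∧
  ∃ (P : W → Fin (k + 1)) (H : SimpleGraph W),
    H ≤ G ∧ (∀ u v, H.Adj u v → P u = P v) ∧
    MemF i j (H.induce (P ⁻¹' {0})) ∧
    ((g = 4 ∧ ∀ l : Fin (k + 1), l ≠ 0 → Nonempty ((H.induce (P ⁻¹' {l})) ≃g Lgraph)) ∨
     (g = 5 ∧ ∀ l : Fin (k + 1), l ≠ 0 → Nonempty ((H.induce (P ⁻¹' {l})) ≃g Rgraph))) ∧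
    (G.edgeSet \ H.edgeSet).ncard = k + 1 ∧
    (1 ≤ k → ∀ u v, G.Adj u v → ¬ H.Adj u v → P u ≠ P v)

/-- `t_4 = 2/9`, `t_5 = 1/5`. -/
noncomputable def tg (g : ℕ) : ℝ := if g = 4 then 2 / 9 else 1 / 5

/-- The error function `ε_g` on graphs. -/
noncomputable def eps (g : ℕ) {V : Type} (G : SimpleGraph V) : ℝ := by
  classical
  exact
    if h1 : ∃ p : ℕ × ℕ, 1 ≤ p.1 ∧ p.2 ≤ p.1 ∧ MemF p.1 p.2 G then
      max (1 - (h1.choose.2 : ℝ) * (5 * tg g - 1) - (h1.choose.1 : ℝ) * tg g) 0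
    else if h2 : ∃ q : ℕ × ℕ × ℕ, 1 ≤ q.1 ∧ q.2.1 ≤ q.1 ∧ MemFG g q.1 q.2.1 q.2.2 G then
      max (1 - tg g - (h2.choose.2.1 : ℝ) * (5 * tg g - 1) - (h2.choose.1 : ℝ) * tg g) 0
    else if Nonempty (G ≃g (⊤ : SimpleGraph (Fin 2))) then -tg g
    else 0

/-- The error function `r_g(G)`: the sum of `ε_g(B)` over all blocks `B` of `G`. -/
noncomputable def rg (g : ℕ) {V : Type} (G : SimpleGraph V) : ℝ :=
  ∑ᶠ B ∈ {B : Set V | IsBlock G B}, eps g (G.induce B)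

/-- `G` has two vertex-disjoint cycles, each of length less than `g`. -/
def TwoDisjointCyclesLt {V : Type} (G : SimpleGraph V) (g : ℕ) : Prop :=
  ∃ (u v : V) (c1 : G.Walk u u) (c2 : G.Walk v v), c1.IsCycle ∧ c2.IsCycle ∧
    c1.length < g ∧ c2.length < g ∧ ∀ x, x ∈ c1.support → x ∉ c2.support

/-- `G` contains a (not necessarily induced) subgraph isomorphic to `K`. -/
def ContainsSubgraphCopy {U V : Type} (K : SimpleGraph U) (G : SimpleGraph V) : Prop :=
  ∃ f : U → V, Function.Injective f ∧ ∀ u v, K.Adj u v → G.Adj (f u) (f v)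

/-- `G` is obtained from `H` by adding edges, each of which is a cut-edge of `G`. -/
def AddCutEdges {V : Type} (H G : SimpleGraph V) : Prop :=
  H ≤ G ∧ ∀ e ∈ G.edgeSet \ H.edgeSet, G.IsBridge e

/-- The edges of `H` all lie inside the parts of the partition given by `P`. -/
def PartitionedBy {V ι : Type} (H : SimpleGraph V) (P : V → ι) : Prop :=
  ∀ u v, H.Adj u v → P u = P v

/-- `G` is `g`-minimal: a minimum counterexample to the main theorem. -/
def GMinimal (g : ℕ) {V : Type} [Fintype V] (G : SimpleGraph V) : Prop :=
  Subcubic G ∧ ¬ TwoDisjointCyclesLt G g ∧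
  tg g * G.edgeSet.ncard + rg g G < (fvs G : ℝ) ∧
  ∀ (W : Type) [Fintype W] (H : SimpleGraph W), Nat.card W < Nat.card V →
    Subcubic H → ¬ TwoDisjointCyclesLt H g →
    (fvs H : ℝ) ≤ tg g * H.edgeSet.ncard + rg g H

/-! ### Adjacency in subdivisions and apex extensions -/

@[simp] lemma subdivide_some_some {V : Type} (H : SimpleGraph V) (x y u v : V) :
    (subdivide H x y).Adj (some u) (some v) ↔ H.Adj u v ∧ s(u, v) ≠ s(x, y) := by
  simp only [subdivide, SimpleGraph.fromRel_adj]
  constructor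
  · rintro ⟨_, h | h⟩
    · exact h
    · exact ⟨h.1.symm, by rw [Sym2.eq_swap]; exact h.2⟩
  · intro h
    exact ⟨by simpa using h.1.ne, Or.inl h⟩

@[simp] lemma subdivide_some_none {V : Type} (H : SimpleGraph V) (x y u : V) :
    (subdivide H x y).Adj (some u) none ↔ u = x ∨ u = y := by
  simp [subdivide, SimpleGraph.fromRel_adj]

@[simp] lemma subdivide_none_some {V : Type} (H : SimpleGraph V) (x y u : V) :
    (subdivide H x y).Adj none (some u) ↔ u = x ∨ u = y := by
  simp [subdivide, SimpleGraph.fromRel_adj]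

@[simp] lemma addApex_some_some {V : Type} (K : SimpleGraph V) (S : Set V) (u v : V) :
    (addApex K S).Adj (some u) (some v) ↔ K.Adj u v := by
  simp only [addApex, SimpleGraph.fromRel_adj]
  constructor
  · rintro ⟨_, h | h⟩
    · exact h
    · exact h.symm
  · intro h
    exact ⟨by simpa using h.ne, Or.inl h⟩

@[simp] lemma addApex_some_none {V : Type} (K : SimpleGraph V) (S : Set V) (u : V) :
    (addApex K S).Adj (some u) none ↔ u ∈ S := by
  simp [addApex, SimpleGraph.fromRel_adj]

@[simp] lemma addApex_none_some {V : Type} (K : SimpleGraph V) (S : Set V) (u : V) :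
    (addApex K S).Adj none (some u) ↔ u ∈ S := by
  simp [addApex, SimpleGraph.fromRel_adj]

lemma map_some_ne {V : Type} (e : Sym2 V) (u : V) :
    Sym2.map (some : V → Option V) e ≠ s(some u, none) := by
  induction e with
  | h a b => simp

lemma apexEdge_injective {V : Type} :
    Function.Injective (fun u : V => s(some u, (none : Option V))) := by
  intro u v h
  simpa using h

lemma addApex_edgeSet {V : Type} (K : SimpleGraph V) (S : Set V) :
    (addApex K S).edgeSet =
      (Sym2.map some '' K.edgeSet) ∪ ((fun u => s(some u, none)) '' S) := by
  ext e
  induction e with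
  | h a b =>
    rw [SimpleGraph.mem_edgeSet]
    constructor
    · intro h
      rcases a with _ | a <;> rcases b with _ | b
      · exact absurd h (by simp)
      · exact Or.inr ⟨b, by simpa using h, Sym2.eq_swap⟩
      · exact Or.inr ⟨a, by simpa using h, rfl⟩
      · exact Or.inl ⟨s(a, b), by simpa using h, rfl⟩
    · rintro (⟨e, he, h⟩ | ⟨u, hu, h⟩)
      · induction e with
        | h c d =>
          rw [← SimpleGraph.mem_edgeSet, ← h]
          simpa using he
      · rw [← SimpleGraph.mem_edgeSet, ← h]
        simpa using hu

lemma subdivide_edgeSet {V : Type} (H : SimpleGraph V) (x y : V) :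
    (subdivide H x y).edgeSet =
      (Sym2.map some '' (H.edgeSet \ {s(x, y)})) ∪ ((fun u => s(some u, none)) '' {x, y}) := by
  ext e
  induction e with
  | h a b =>
    rw [SimpleGraph.mem_edgeSet]
    constructor
    · intro h
      rcases a with _ | a <;> rcases b with _ | b
      · exact absurd h (by simp)
      · exact Or.inr ⟨b, by simpa using h, Sym2.eq_swap⟩
      · exact Or.inr ⟨a, by simpa using h, rfl⟩
      · exact Or.inl ⟨s(a, b), (subdivide_some_some H x y a b).1 h, rfl⟩
    · rintro (⟨e, he, h⟩ | ⟨u, hu, h⟩)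
      · induction e with
        | h c d =>
          rw [← SimpleGraph.mem_edgeSet, ← h]
          exact (subdivide_some_some H x y c d).2 he
      · rw [← SimpleGraph.mem_edgeSet, ← h]
        exact (subdivide_some_none H x y u).2 hu

lemma ncard_apexSplit {V : Type} [Finite V] (A : Set (Sym2 V)) (S : Set V) :
    ((Sym2.map (some : V → Option V) '' A) ∪ ((fun u => s(some u, none)) '' S)).ncard
      = A.ncard + S.ncard := by
  rw [Set.ncard_union_eq, Set.ncard_image_of_injective _
    (Sym2.map.injective (Option.some_injective V)), Set.ncard_image_of_injective _ apexEdge_injective]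
  rw [Set.disjoint_left]
  rintro _ ⟨e, _, rfl⟩ ⟨u, _, h⟩
  exact map_some_ne e u h.symm

lemma subdivide_ncard {V : Type} [Finite V] (H : SimpleGraph V) {x y : V} (h : H.Adj x y) :
    (subdivide H x y).edgeSet.ncard = H.edgeSet.ncard + 1 := by
  rw [subdivide_edgeSet, ncard_apexSplit, Set.ncard_pair h.ne]
  have := Set.ncard_sdiff_singleton_add_one (s := H.edgeSet) (a := s(x, y)) h (Set.toFinite _)
  omega

lemma addApex_ncard {V : Type} [Finite V] (K : SimpleGraph V) (S : Set V) :
    (addApex K S).edgeSet.ncard = K.edgeSet.ncard + S.ncard := by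
  rw [addApex_edgeSet, ncard_apexSplit]

lemma iso_ncard {V W : Type} {G : SimpleGraph V} {H : SimpleGraph W} (f : G ≃g H) :
    G.edgeSet.ncard = H.edgeSet.ncard := by
  have := Nat.card_congr f.mapEdgeSet
  simpa [Set.ncard] using this

lemma cyc_ncard {i : ℕ} (hi : 3 ≤ i) : (cyc i).edgeSet.ncard = i := by
  have : (cyc i).edgeSet = (fun k : ZMod i => s(k, k + 1)) '' Set.univ := by
    have h1 : (1 : ZMod i) ≠ 0 := by
      intro h
      have := (ZMod.natCast_eq_zero_iff 1 i).1 (by exact_mod_cast h)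
      exact absurd (Nat.le_of_dvd one_pos this) (by omega)
    ext e
    induction e with
    | h a b =>
      simp only [SimpleGraph.mem_edgeSet, cyc, SimpleGraph.fromRel_adj, Set.mem_image, Set.mem_univ,
        true_and]
      constructor
      · rintro ⟨_, h | h⟩
        · exact ⟨a, by rw [h]⟩
        · exact ⟨b, by rw [h, Sym2.eq_swap]⟩
      · rintro ⟨k, hk⟩
        rw [Sym2.eq_iff] at hk
        rcases hk with ⟨rfl, rfl⟩ | ⟨rfl, rfl⟩
        · exact ⟨by simpa using h1, Or.inl rfl⟩
        · exact ⟨by simpa using h1, Or.inr rfl⟩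
  rw [this, Set.ncard_image_of_injective, Set.ncard_univ, Nat.card_zmod]
  intro a b hab
  simp only [Sym2.eq_iff] at hab
  rcases hab with h | ⟨h, h'⟩
  · exact h.1
  · exfalso
    have h2 : ((2 : ℕ) : ZMod i) = 0 := by
      push_cast
      have : b + 1 + 1 = b := by rw [← h]; exact h'
      have : b + 2 = b + 0 := by rw [add_zero]; rw [← one_add_one_eq_two, ← add_assoc]; exact this
      exact add_left_cancel this
    have := (ZMod.natCast_eq_zero_iff 2 i).1 h2
    exact absurd (Nat.le_of_dvd two_pos this) (by omega)

lemma k4_ncard : (⊤ : SimpleGraph (Fin 4)).edgeSet.ncard = 6 := by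
  rw [← SimpleGraph.coe_edgeFinset, Set.ncard_coe_finset, SimpleGraph.card_edgeFinset_top_eq_card_choose_two]
  rfl

/-- Vertex and edge counts of the members of `F_{i,j}`. -/
lemma MemF.counts {i j : ℕ} {V : Type} {G : SimpleGraph V} (h : MemF i j G) :
    Finite V ∧ Nat.card V = 3 * j + i ∧ G.edgeSet.ncard = 5 * j + i ∧ j ≤ i ∧ (j = 0 → 3 ≤ i) := by
  induction h with
  | @cycle i hi V G h =>
    obtain ⟨f⟩ := h
    have : NeZero i := ⟨by omega⟩
    refine ⟨Finite.of_equiv _ f.toEquiv.symm, ?_, ?_, by omega, by omega⟩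
    · rw [Nat.card_congr f.toEquiv, Nat.card_zmod]; omega
    · rw [iso_ncard f, cyc_ncard hi]; omega
  | @k4 V G h =>
    obtain ⟨f⟩ := h
    refine ⟨Finite.of_equiv _ f.toEquiv.symm, ?_, ?_, by omega, by omega⟩
    · rw [Nat.card_congr f.toEquiv]; simp
    · rw [iso_ncard f, k4_ncard]
  | @circ j hj V H hH x y hxy e1 e2 he1 he2 W G hG ih =>
    obtain ⟨hfin, hV, hE, hle, -⟩ := ih
    have hS := subdivide_ncard H hxy
    have key : ∀ (x1 y1 : Option V) (a b : Option (Option V)), (subdivide H x y).Adj x1 y1 →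
        (subdivide (subdivide H x y) x1 y1).Adj a b →
        Nonempty (G ≃g addApex (subdivide (subdivide (subdivide H x y) x1 y1) a b)
          {some (some none), some none, none}) →
        Finite W ∧ Nat.card W = 3 * j + j ∧ G.edgeSet.ncard = 5 * j + j := by
      rintro x1 y1 a b h1 h2 ⟨f⟩
      refine ⟨Finite.of_equiv _ f.toEquiv.symm, ?_, ?_⟩
      · rw [Nat.card_congr f.toEquiv]
        simp only [Finite.card_option, hV]
        omega
      · rw [iso_ncard f, addApex_ncard, subdivide_ncard _ h2, subdivide_ncard _ h1, hS, hE]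
        have : ({some (some none), some none, none} : Set (Option (Option (Option V)))).ncard = 3 := by
          rw [Set.ncard_eq_three]
          exact ⟨_, _, _, by simp, by simp, by simp, rfl⟩
        rw [this]; omega
    obtain ⟨a, b, c⟩ : Finite W ∧ Nat.card W = 3 * j + j ∧ G.edgeSet.ncard = 5 * j + j := by
      rcases hG with ⟨hne, x1, y1, x2, y2, rfl, rfl, hf⟩ | ⟨rfl, x1, y1, rfl, hf⟩
      · exact key x1 y1 _ _ he1 ((subdivide_some_some _ _ _ _ _).2 ⟨he2, hne.symm⟩) hf
      · exact key x1 y1 _ _ he1 ((subdivide_none_some _ _ _ _).2 (Or.inr rfl)) hf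
    exact ⟨a, b, c, le_rfl, by omega⟩
  | @subd i j hj V H hH x y hxy W G hG ih =>
    obtain ⟨hfin, hV, hE, hle, h0⟩ := ih
    obtain ⟨f⟩ := hG
    refine ⟨Finite.of_equiv _ f.toEquiv.symm, ?_, ?_, by omega, by omega⟩
    · rw [Nat.card_congr f.toEquiv]
      simp only [Finite.card_option, hV]
      omega
    · rw [iso_ncard f, subdivide_ncard _ hxy, hE]
      omega

lemma MemF.of_iso {i j : ℕ} {V W : Type} {G : SimpleGraph V} {G' : SimpleGraph W}
    (h : MemF i j G) (f : G' ≃g G) : MemF i j G' := by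
  cases h with
  | cycle hi h => exact .cycle hi (h.map fun g => f.trans g)
  | k4 h => exact .k4 (h.map fun g => f.trans g)
  | circ hj hH hxy he1 he2 hG =>
    refine .circ hj hH hxy he1 he2 ?_
    rcases hG with ⟨hne, x1, y1, x2, y2, h1, h2, hf⟩ | ⟨hne, x1, y1, h1, hf⟩
    · exact Or.inl ⟨hne, x1, y1, x2, y2, h1, h2, hf.map fun g => f.trans g⟩
    · exact Or.inr ⟨hne, x1, y1, h1, hf.map fun g => f.trans g⟩
  | subd hj hH hxy hG => exact .subd hj hH hxy (hG.map fun g => f.trans g)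

/-- Subdivision is compatible with isomorphism. -/
def subdivideIso {V W : Type} {H : SimpleGraph V} {K : SimpleGraph W} (f : H ≃g K) (x y : V) :
    subdivide H x y ≃g subdivide K (f x) (f y) where
  toEquiv := Equiv.optionCongr f.toEquiv
  map_rel_iff' := by
    rintro (_ | a) (_ | b)
    · simp
    · simp
    · simp
    · simp [f.map_adj_iff]

lemma subdivide_comm {V : Type} (H : SimpleGraph V) (x y : V) :
    subdivide H x y = subdivide H y x := by
  ext a b
  rcases a with _ | a <;> rcases b with _ | b <;> simp [or_comm, Sym2.eq_swap (a := x)]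

lemma MemF.one_one {V : Type} {G : SimpleGraph V} (h : MemF 1 1 G) :
    Nonempty (G ≃g (⊤ : SimpleGraph (Fin 4))) := by
  cases h with
  | k4 h => exact h
  | circ hj => omega
  | subd hj hH => have := hH.counts; omega

lemma MemF.two_one {V : Type} {G : SimpleGraph V} (h : MemF 2 1 G) : Nonempty (G ≃g K4plus) := by
  cases h with
  | @subd _ _ hj V H hH x y hxy W _ hG =>
    obtain ⟨f⟩ := hH.one_one
    obtain ⟨g⟩ := hG
    have h4 : ∀ a b : Fin 4, a ≠ b → ∃ σ : Equiv.Perm (Fin 4), σ a = 0 ∧ σ b = 1 := by decide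
    obtain ⟨σ, h0, h1⟩ := h4 (f x) (f y) (f.injective.ne hxy.ne)
    let τ : (⊤ : SimpleGraph (Fin 4)) ≃g (⊤ : SimpleGraph (Fin 4)) :=
      ⟨σ, by intro a b; simp⟩
    have := subdivideIso τ (f x) (f y)
    have e0 : τ (f x) = 0 := h0
    have e1 : τ (f y) = 1 := h1
    rw [e0, e1] at this
    exact ⟨(g.trans (subdivideIso f x y)).trans this⟩

lemma MemF.three_zero {V : Type} {G : SimpleGraph V} {i : ℕ} (h : MemF i 0 G) :
    Nonempty (G ≃g cyc i) := by
  cases h with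
  | cycle _ h => exact h
  | circ hj => omega
  | subd hj => omega

lemma memF_K4plus : MemF 2 1 K4plus :=
  .subd le_rfl (.k4 ⟨SimpleGraph.Iso.refl⟩) (x := 0) (y := 1) (by simp) ⟨SimpleGraph.Iso.refl⟩

lemma memF_Lgraph : MemF 3 1 Lgraph :=
  .subd le_rfl memF_K4plus (x := some 2) (y := some 3) (by simp [K4plus])
    ⟨SimpleGraph.Iso.refl⟩

/-- `G` contains a triangle. -/
def HasTri {V : Type} (G : SimpleGraph V) : Prop :=
  ∃ a b c : V, G.Adj a b ∧ G.Adj a c ∧ G.Adj b c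

lemma HasTri.map {V W : Type} {G : SimpleGraph V} {H : SimpleGraph W} (h : HasTri G)
    (f : V → W) (hf : ∀ a b, G.Adj a b → H.Adj (f a) (f b)) : HasTri H := by
  obtain ⟨a, b, c, h1, h2, h3⟩ := h
  exact ⟨f a, f b, f c, hf _ _ h1, hf _ _ h2, hf _ _ h3⟩

lemma HasTri.of_iso {V W : Type} {G : SimpleGraph V} {H : SimpleGraph W} (h : HasTri G)
    (f : H ≃g G) : HasTri H :=
  h.map f.symm fun _ _ hab => f.symm.map_adj_iff.2 hab

lemma hasTri_K4plus : HasTri K4plus :=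
  ⟨some 0, some 2, some 3, by simp [K4plus], by simp [K4plus], by simp [K4plus]⟩

lemma hasTri_cyc3 : HasTri (cyc 3) := by
  refine ⟨0, 1, 2, ?_, ?_, ?_⟩ <;> simp only [cyc, SimpleGraph.fromRel_adj] <;> decide

lemma MemF.three_one {V : Type} {G : SimpleGraph V} (h : MemF 3 1 G) :
    Nonempty (G ≃g Lgraph) ∨ HasTri G := by
  cases h with
  | @subd _ _ hj V H hH x y hxy W _ hG =>
    obtain ⟨f⟩ := hH.two_one
    obtain ⟨g⟩ := hG
    have e := g.trans (subdivideIso f x y)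
    have hadj : K4plus.Adj (f x) (f y) := f.map_adj_iff.2 hxy
    generalize f x = p at e hadj
    generalize f y = q at e hadj
    by_cases h1 : s(p, q) = s(some 2, some 3)
    · left
      rw [Sym2.eq_iff] at h1
      rcases h1 with ⟨rfl, rfl⟩ | ⟨rfl, rfl⟩
      · exact ⟨e⟩
      · rw [subdivide_comm] at e
        exact ⟨e⟩
    · right
      refine HasTri.of_iso ?_ e
      by_cases h2 : s(p, q) = s(some 0, some 2) ∨ s(p, q) = s(some 0, some 3)
      · refine ⟨some (some 1), some (some 2), some (some 3), ?_, ?_, ?_⟩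
        all_goals
          rw [subdivide_some_some]
          refine ⟨by simp [K4plus], ?_⟩
          rcases h2 with h2 | h2 <;> rw [h2] <;> decide
      · push Not at h2
        refine ⟨some (some 0), some (some 2), some (some 3), ?_, ?_, ?_⟩
        all_goals
          rw [subdivide_some_some]
          refine ⟨by simp [K4plus], ?_⟩
          first | exact h2.1.symm | exact h2.2.symm | exact fun h => h1 h.symm

/-! ### Edge counts and the classification of the values of `ε_4` -/

lemma degree_eq_ncard {V : Type} [Fintype V] (G : SimpleGraph V) [DecidableRel G.Adj] (v : V) :
    G.degree v = (G.neighborSet v).ncard := by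
  rw [← SimpleGraph.card_neighborSet_eq_degree, ← Nat.card_eq_fintype_card]
  rfl

lemma sum_ncard_neighborSet {V : Type} [Fintype V] (G : SimpleGraph V) :
    ∑ v, (G.neighborSet v).ncard = 2 * G.edgeSet.ncard := by
  classical
  have := G.sum_degrees_eq_twice_card_edges
  simp only [degree_eq_ncard] at this
  rw [this, ← SimpleGraph.coe_edgeFinset, Set.ncard_coe_finset]

lemma Subcubic.handshake {V : Type} [Finite V] {G : SimpleGraph V} (h : Subcubic G) :
    2 * G.edgeSet.ncard ≤ 3 * Nat.card V := by
  have := Fintype.ofFinite V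
  rw [← sum_ncard_neighborSet]
  calc _ ≤ ∑ v : V, 3 := Finset.sum_le_sum fun v _ => h v
    _ = 3 * Nat.card V := by simp [mul_comm]

lemma Subcubic.cubic {V : Type} [Finite V] {G : SimpleGraph V} (h : Subcubic G)
    (h2 : 2 * G.edgeSet.ncard = 3 * Nat.card V) : Cubic G := by
  have := Fintype.ofFinite V
  rw [← sum_ncard_neighborSet] at h2
  have h3 : ∑ v, (G.neighborSet v).ncard = ∑ v : V, 3 := by
    rw [h2]; simp [mul_comm]
  intro v
  exact (Finset.sum_eq_sum_iff_of_le fun v _ => h v).1 h3 v (Finset.mem_univ v)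

lemma ncard_neighborSet_induce {V : Type} [Finite V] (G : SimpleGraph V) (C : Set V) (v : C) :
    ((G.induce C).neighborSet v).ncard = (G.neighborSet v ∩ C).ncard := by
  rw [← Set.ncard_image_of_injective _ Subtype.val_injective]
  congr 1
  ext w
  simp only [Set.mem_image, SimpleGraph.mem_neighborSet, SimpleGraph.comap_adj, Set.mem_inter_iff,
    Function.Embedding.subtype_apply]
  constructor
  · rintro ⟨x, hx, rfl⟩
    exact ⟨hx, x.2⟩
  · rintro ⟨h1, h2⟩
    exact ⟨⟨w, h2⟩, h1, rfl⟩

lemma Subcubic.induce {V : Type} [Finite V] {G : SimpleGraph V} (h : Subcubic G) (C : Set V) :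
    Subcubic (G.induce C) := by
  intro v
  rw [ncard_neighborSet_induce]
  exact (Set.ncard_le_ncard Set.inter_subset_left).trans (h v)

lemma ncard_partition {W : Type} [Fintype W] {n : ℕ} (P : W → Fin n) (H : SimpleGraph W)
    (hP : ∀ u v, H.Adj u v → P u = P v) :
    2 * H.edgeSet.ncard = ∑ l, 2 * (H.induce (P ⁻¹' {l})).edgeSet.ncard := by
  classical
  rw [← sum_ncard_neighborSet, ← Finset.sum_fiberwise (s := Finset.univ) (g := P)]
  refine Finset.sum_congr rfl fun l _ => ?_
  rw [← sum_ncard_neighborSet]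
  rw [← Finset.sum_subtype_of_mem (p := fun v => v ∈ P ⁻¹' {l})
    (fun v => (H.neighborSet v).ncard) (by intro x hx; simpa using hx)]
  have : Finset.subtype (fun v => v ∈ P ⁻¹' {l}) {i | P i = l} = Finset.univ := by
    ext x
    have : P x = l := x.2
    simpa using this
  rw [this]
  refine Finset.sum_congr rfl fun v _ => ?_
  rw [ncard_neighborSet_induce]
  congr 1
  ext w
  have hv : P v = l := v.2
  simp only [Set.mem_inter_iff, Set.mem_preimage, Set.mem_singleton_iff,
    SimpleGraph.mem_neighborSet]
  exact ⟨fun h => ⟨h, (hP _ _ h).symm.trans hv⟩, fun h => h.1⟩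

lemma card_partition {W : Type} [Fintype W] {n : ℕ} (P : W → Fin n) :
    Nat.card W = ∑ l, Nat.card (P ⁻¹' {l}) := by
  rw [Nat.card_congr (Equiv.sigmaFiberEquiv P).symm, Nat.card_sigma]
  rfl

lemma TwoConnected.finite {W : Type} {G : SimpleGraph W} (h : TwoConnected G) : Finite W :=
  (Nat.card_pos_iff.1 (by have := h.1; omega)).2

lemma MemFG.counts {i j k : ℕ} {W : Type} {G : SimpleGraph W} (h : MemFG 4 i j k G) :
    3 ≤ Nat.card W ∧ j + 2 ≤ i ∧ (j = 0 → 3 ≤ i) ∧ (i = 3 → j = 0 → 1 ≤ k) := by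
  obtain ⟨h2, hsub, P, H, hle, hP, hF, hL, hE, -⟩ := h
  have := h2.finite
  have := Fintype.ofFinite W
  obtain ⟨-, hV0, hE0, hji, h3⟩ := hF.counts
  rcases hL with ⟨-, hL⟩ | ⟨h, -⟩
  swap
  · omega
  have hc : ∀ l : Fin (k + 1), l ≠ 0 → Nat.card (P ⁻¹' {l}) = 6 ∧
      (H.induce (P ⁻¹' {l})).edgeSet.ncard = 8 := by
    intro l hl
    obtain ⟨f⟩ := hL l hl
    obtain ⟨-, a, b, -⟩ := (memF_Lgraph.of_iso f).counts
    exact ⟨a, b⟩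
  have hV : Nat.card W = 3 * j + i + 6 * k := by
    rw [card_partition P, Fin.sum_univ_succ, hV0,
      Finset.sum_congr rfl fun l _ => (hc l.succ (Fin.succ_ne_zero l)).1]
    simp [mul_comm]
  have hH : 2 * H.edgeSet.ncard = 2 * (5 * j + i) + 16 * k := by
    rw [ncard_partition P H hP, Fin.sum_univ_succ, hE0,
      Finset.sum_congr rfl fun l _ => by rw [(hc l.succ (Fin.succ_ne_zero l)).2]]
    simp [mul_comm]
  have hG : G.edgeSet.ncard = H.edgeSet.ncard + (k + 1) := by
    rw [← hE, ← Set.ncard_sdiff_add_ncard_of_subset (SimpleGraph.edgeSet_mono hle)]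
    omega
  have hs := hsub.handshake
  refine ⟨h2.1, by omega, h3, ?_⟩
  rintro rfl rfl
  by_contra hk
  have hk : k = 0 := by omega
  subst hk
  classical
  have h6 := G.card_edgeFinset_le_card_choose_two
  rw [← Nat.card_eq_fintype_card, hV, ← Set.ncard_coe_finset, SimpleGraph.coe_edgeFinset] at h6
  have : Nat.choose (3 * 0 + 3 + 6 * 0) 2 = 3 := rfl
  omega

lemma MemFG.hasTri {k : ℕ} {W : Type} {G : SimpleGraph W} (h : MemFG 4 3 0 k G) : HasTri G := by
  obtain ⟨h2, hsub, P, H, hle, hP, hF, -⟩ := h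
  obtain ⟨f⟩ := hF.three_zero
  exact (hasTri_cyc3.of_iso f).map Subtype.val fun _ _ hab => hle hab

/-- The classification of the values of `ε_4`. -/
lemma eps_cases {V : Type} (G : SimpleGraph V) :
    ∃ m : ℤ, eps 4 G = m / 9 ∧
      ((m = 6 ∧ MemF 1 1 G) ∨ (m = 4 ∧ MemF 2 1 G) ∨ (m = 3 ∧ (MemF 3 0 G ∨ MemF 2 2 G)) ∨
       (m = 2 ∧ MemF 3 1 G) ∨
       (m = 1 ∧ (MemF 3 2 G ∨ MemF 4 0 G ∨ ∃ k, 1 ≤ k ∧ MemFG 4 3 0 k G)) ∨ m ≤ 0) := by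
  unfold eps
  split_ifs with h1 h2 h3
  · obtain ⟨hi, hj, hF⟩ := h1.choose_spec
    generalize h1.choose = p at hi hj hF
    obtain ⟨i, j⟩ := p
    dsimp only at hi hj hF ⊢
    obtain ⟨-, -, -, -, h0⟩ := hF.counts
    refine ⟨max (9 - j - 2 * i) 0, ?_, ?_⟩
    · push_cast
      rw [← max_div_div_right (by norm_num)]
      congr 1
      · simp only [tg, if_true]; ring
      · simp
    · by_cases hpos : 2 * i + j < 9
      · have hm : max (9 - (j : ℤ) - 2 * i) 0 = 9 - j - 2 * i := max_eq_left (by omega)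
        rw [hm]
        have hi4 : i ≤ 4 := by omega
        have hj4 : j ≤ 4 := by omega
        interval_cases i <;> interval_cases j <;> first | omega | simp_all
      · right; right; right; right; right
        exact max_le (by omega) le_rfl
  · obtain ⟨hi, hj, hF⟩ := h2.choose_spec
    generalize h2.choose = p at hi hj hF
    obtain ⟨i, j, k⟩ := p
    dsimp only at hi hj hF ⊢
    obtain ⟨-, h0, h30, hk⟩ := hF.counts
    refine ⟨max (7 - j - 2 * i) 0, ?_, ?_⟩
    · push_cast
      rw [← max_div_div_right (by norm_num)]
      congr 1
      · simp only [tg, if_true]; ring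
      · simp
    · by_cases hpos : 2 * i + j < 7
      · have : i = 3 ∧ j = 0 := by omega
        obtain ⟨rfl, rfl⟩ := this
        right; right; right; right; left
        exact ⟨by norm_num, Or.inr (Or.inr ⟨k, hk rfl rfl, hF⟩)⟩
      · right; right; right; right; right
        exact max_le (by omega) le_rfl
  · exact ⟨-2, by simp [tg]; norm_num, by omega⟩
  · exact ⟨0, by simp, by omega⟩

lemma eps_small {V : Type} [Finite V] (G : SimpleGraph V) (h : Nat.card V < 3) :
    (Nonempty (G ≃g (⊤ : SimpleGraph (Fin 2))) → eps 4 G = -(2 / 9)) ∧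
      (Nat.card V = 1 → eps 4 G = 0) ∧ eps 4 G ≤ 0 := by
  have n1 : ¬ ∃ p : ℕ × ℕ, 1 ≤ p.1 ∧ p.2 ≤ p.1 ∧ MemF p.1 p.2 G := by
    rintro ⟨p, _, _, hF⟩
    obtain ⟨-, a, -, b, c⟩ := hF.counts
    omega
  have n2 : ¬ ∃ q : ℕ × ℕ × ℕ, 1 ≤ q.1 ∧ q.2.1 ≤ q.1 ∧ MemFG 4 q.1 q.2.1 q.2.2 G := by
    rintro ⟨p, _, _, hF⟩
    have := hF.counts
    omega
  unfold eps
  rw [dif_neg n1, dif_neg n2]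
  refine ⟨?_, ?_, ?_⟩
  · intro hn
    rw [if_pos hn]; simp [tg]
  · intro hn
    rw [if_neg]
    rintro ⟨f⟩
    have := Nat.card_congr f.toEquiv
    simp [hn] at this
  · split_ifs
    · simp [tg]; norm_num
    · exact le_rfl

/-! ### Counting bridges -/

lemma card_cc_bridge {V : Type} [Finite V] (G : SimpleGraph V) {u v : V} (huv : G.Adj u v)
    (hb : G.IsBridge s(u, v)) :
    Nat.card (G.deleteEdges {s(u, v)}).ConnectedComponent = Nat.card G.ConnectedComponent + 1 := by
  classical
  rw [SimpleGraph.isBridge_iff] at hb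
  set D := G.deleteEdges {s(u, v)} with hD
  have hDG : D ≤ G := SimpleGraph.deleteEdges_le _
  let φ : {c : D.ConnectedComponent // c ≠ D.connectedComponentMk v} → G.ConnectedComponent :=
    fun c => c.1.map (SimpleGraph.Hom.ofLE hDG)
  let ψ : V → D.ConnectedComponent := fun a =>
    if D.Reachable a v then D.connectedComponentMk u else D.connectedComponentMk a
  have hψ : ∀ a b, G.Adj a b → ψ a = ψ b := by
    intro a b hab
    by_cases he : s(a, b) = s(u, v)
    · rw [Sym2.eq_iff] at he
      rcases he with ⟨rfl, rfl⟩ | ⟨rfl, rfl⟩ <;> simp [ψ]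
    · have hDab : D.Adj a b := by
        rw [hD, SimpleGraph.deleteEdges_adj]
        exact ⟨hab, he⟩
      have h1 : D.Reachable a v ↔ D.Reachable b v :=
        ⟨fun h => hDab.symm.reachable.trans h, fun h => hDab.reachable.trans h⟩
      have h2 : D.connectedComponentMk a = D.connectedComponentMk b :=
        SimpleGraph.ConnectedComponent.sound hDab.reachable
      simp only [ψ, h1, h2]
  have hψ' : ∀ a b, G.Reachable a b → ψ a = ψ b := by
    rintro a b ⟨p⟩
    induction p with
    | nil => rfl
    | cons h p ih => exact (hψ _ _ h).trans ih
  have hφ : Function.Bijective φ := by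
    constructor
    · rintro ⟨c, hc⟩ ⟨d, hd⟩ h
      induction c using SimpleGraph.ConnectedComponent.ind with | h a => ?_
      induction d using SimpleGraph.ConnectedComponent.ind with | h b => ?_
      have h' : G.Reachable a b := SimpleGraph.ConnectedComponent.exact h
      have := hψ' a b h'
      have ha : ¬ D.Reachable a v := fun h => hc (SimpleGraph.ConnectedComponent.sound h)
      have hb' : ¬ D.Reachable b v := fun h => hd (SimpleGraph.ConnectedComponent.sound h)
      simp only [ψ, ha, hb', if_false] at this
      exact Subtype.ext this
    · intro c
      induction c using SimpleGraph.ConnectedComponent.ind with | h a => ?_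
      by_cases ha : D.Reachable a v
      · refine ⟨⟨D.connectedComponentMk u, fun h => hb (SimpleGraph.ConnectedComponent.exact h)⟩, ?_⟩
        exact SimpleGraph.ConnectedComponent.sound (huv.reachable.trans (ha.mono hDG).symm)
      · exact ⟨⟨D.connectedComponentMk a, fun h => ha (SimpleGraph.ConnectedComponent.exact h)⟩, rfl⟩
  rw [← Nat.card_congr (Equiv.ofBijective φ hφ), ← Finite.card_option,
    Nat.card_congr (Equiv.optionSubtypeNe (D.connectedComponentMk v))]

lemma card_cc_bridges {V : Type} [Finite V] (G : SimpleGraph V) (S : Set (Sym2 V))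
    (hS : ∀ e ∈ S, e ∈ G.edgeSet ∧ G.IsBridge e) :
    Nat.card (G.deleteEdges S).ConnectedComponent = Nat.card G.ConnectedComponent + S.ncard := by
  induction S, Set.toFinite S using Set.Finite.induction_on with
  | empty => simp
  | @insert e S he hfin ih =>
    have ih := ih fun e he => hS e (Or.inr he)
    rw [Set.ncard_insert_of_notMem he, ← add_assoc, ← ih]
    have h1 : G.deleteEdges (insert e S) = (G.deleteEdges S).deleteEdges {e} := by
      rw [SimpleGraph.deleteEdges_deleteEdges, Set.union_singleton]
    rw [h1]
    obtain ⟨h2, h3⟩ := hS e (Or.inl rfl)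
    have h4 := h3.anti (SimpleGraph.deleteEdges_le S)
    induction e with
    | h u v =>
      exact card_cc_bridge _ (by rw [SimpleGraph.deleteEdges_adj]; exact ⟨h2, he⟩) h4

/-- The set of bridges (cut-edges). -/
def bridges {V : Type} (G : SimpleGraph V) : Set (Sym2 V) := {e | e ∈ G.edgeSet ∧ G.IsBridge e}

/-- The graph obtained by deleting all bridges. -/
def core {V : Type} (G : SimpleGraph V) : SimpleGraph V := G.deleteEdges (bridges G)

lemma core_le {V : Type} (G : SimpleGraph V) : core G ≤ G := SimpleGraph.deleteEdges_le _

lemma core_adj {V : Type} {G : SimpleGraph V} {a b : V} :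
    (core G).Adj a b ↔ G.Adj a b ∧ ¬ G.IsBridge s(a, b) := by
  rw [core, SimpleGraph.deleteEdges_adj]
  simp only [bridges, Set.mem_ofPred_eq, SimpleGraph.mem_edgeSet]
  tauto

lemma core_le_delete {V : Type} {G : SimpleGraph V} {a b : V} (h : G.IsBridge s(a, b)) :
    core G ≤ G.deleteEdges {s(a, b)} := by
  intro c d hcd
  rw [core_adj] at hcd
  rw [SimpleGraph.deleteEdges_adj]
  refine ⟨hcd.1, fun he => hcd.2 ?_⟩
  rw [Set.mem_singleton_iff] at he
  rwa [he]

lemma not_reachable_core {V : Type} {G : SimpleGraph V} {a b : V} (h : G.IsBridge s(a, b)) :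
    ¬ (core G).Reachable a b := fun hr => h (hr.mono (core_le_delete h))

lemma induce_core {V : Type} (G : SimpleGraph V) (c : (core G).ConnectedComponent) :
    (core G).induce c.supp = G.induce c.supp := by
  ext a b
  simp only [SimpleGraph.comap_adj, Function.Embedding.subtype_apply]
  refine ⟨fun h => core_le G h, fun h => core_adj.2 ⟨h, fun hb => ?_⟩⟩
  refine not_reachable_core hb (SimpleGraph.ConnectedComponent.exact ?_)
  exact a.2.trans b.2.symm

/-! ### Blocks -/

lemma not_isCutVertex_iff {V : Type} [Finite V] {K : SimpleGraph V} (hK : K.Connected) (v : V) :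
    ¬ IsCutVertex K v ↔ (K.induce {u | u ≠ v}).Preconnected := by
  have h1 : Nat.card K.ConnectedComponent = 1 := by
    have := hK.nonempty
    rw [Nat.card_eq_one_iff_unique]
    exact ⟨hK.preconnected.subsingleton_connectedComponent, inferInstance⟩
  rw [IsCutVertex, h1, not_lt, Finite.card_le_one_iff_subsingleton]
  constructor
  · intro h a b
    exact SimpleGraph.ConnectedComponent.exact (Subsingleton.elim _ _)
  · intro h
    exact h.subsingleton_connectedComponent

/-- `G[B]` is connected and has no cut-vertex. -/
def Good {V : Type} (G : SimpleGraph V) (B : Set V) : Prop :=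
  (G.induce B).Connected ∧ ∀ v, ¬ IsCutVertex (G.induce B) v

lemma good_bridge {V : Type} [Finite V] {G : SimpleGraph V} {B : Set V} (hB : Good G B)
    {x y : V} (hx : x ∈ B) (hy : y ∈ B) (hb : G.IsBridge s(x, y)) : B = {x, y} := by
  have hxy : x ≠ y := by
    rintro rfl
    exact hb (SimpleGraph.Reachable.refl _)
  apply Set.Subset.antisymm
  · intro w hw
    by_contra hne
    simp only [Set.mem_insert_iff, Set.mem_singleton_iff, not_or] at hne
    have key : ∀ z t : V, ∀ (_ : z ∈ B) (_ : t ∈ B), z ≠ t → w ≠ t → s(x, y) = s(z, t) →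
        (G.deleteEdges {s(x, y)}).Reachable z w := by
      intro z t hz ht hzt hwt he
      have h1 := (not_isCutVertex_iff hB.1 ⟨t, ht⟩).1 (hB.2 ⟨t, ht⟩)
        ⟨⟨z, hz⟩, fun h => hzt (congrArg Subtype.val h)⟩
        ⟨⟨w, hw⟩, fun h => hwt (congrArg Subtype.val h)⟩
      let f : (G.induce B).induce {u | u ≠ ⟨t, ht⟩} →g G.deleteEdges {s(x, y)} :=
        { toFun := fun a => a.1.1
          map_rel' := by
            intro a b hab
            rw [SimpleGraph.deleteEdges_adj]
            refine ⟨hab, fun h => ?_⟩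
            rw [Set.mem_singleton_iff, he, Sym2.eq_iff] at h
            rcases h with ⟨-, h⟩ | ⟨h, -⟩
            · exact b.2 (Subtype.ext h)
            · exact a.2 (Subtype.ext h) }
      exact h1.map f
    exact hb ((key x y hx hy hxy hne.2 rfl).trans
      (key y x hy hx hxy.symm hne.1 Sym2.eq_swap).symm)
  · rintro w (rfl | rfl)
    · exact hx
    · exact hy

lemma good_pair {V : Type} [Finite V] {G : SimpleGraph V} {x y : V} (h : G.Adj x y) :
    Good G {x, y} := by
  have hc := SimpleGraph.induce_pair_connected_of_adj h
  refine ⟨hc, fun v => (not_isCutVertex_iff hc v).2 ?_⟩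
  rintro ⟨⟨a, ha⟩, ha'⟩ ⟨⟨b, hb⟩, hb'⟩
  have : a = b := by
    obtain ⟨v, hv⟩ := v
    simp only [Set.mem_ofPred_eq, ne_eq, Subtype.mk.injEq, Set.mem_insert_iff,
      Set.mem_singleton_iff] at ha hb ha' hb' hv
    grind
  subst this
  exact SimpleGraph.Reachable.refl _

lemma reach_neighbour {V : Type} {K : SimpleGraph V} {v w : V} (p : K.Walk w v) (hw : w ≠ v) :
    ∃ (x : V) (hx : x ≠ v), K.Adj v x ∧
      (K.induce {u | u ≠ v}).Reachable ⟨w, hw⟩ ⟨x, hx⟩ := by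
  induction p with
  | nil => exact absurd rfl hw
  | @cons w w' v h p ih =>
    by_cases hw' : w' = v
    · subst hw'
      exact ⟨w, hw, h.symm, SimpleGraph.Reachable.refl _⟩
    · obtain ⟨x, hx, h1, h2⟩ := ih hw'
      have h3 : (K.induce {u | u ≠ v}).Adj ⟨w, hw⟩ ⟨w', hw'⟩ := h
      exact ⟨x, hx, h1, h3.reachable.trans h2⟩

/-- A connected bridgeless subcubic graph has no cut-vertex. -/
lemma bridgeless {V : Type} [Finite V] {K : SimpleGraph V} (hK : K.Connected) (hs : Subcubic K)
    (hb : ∀ a b, K.Adj a b → ¬ K.IsBridge s(a, b)) (v : V) : ¬ IsCutVertex K v := by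
  rw [not_isCutVertex_iff hK]
  set D := K.induce {u | u ≠ v} with hD
  have step2 : ∀ (x : V) (hx : x ≠ v), K.Adj v x →
      ∃ (y : V) (hy : y ≠ v), y ≠ x ∧ K.Adj v y ∧ D.Reachable ⟨x, hx⟩ ⟨y, hy⟩ := by
    intro x hx hvx
    have h1 := hb x v hvx.symm
    rw [SimpleGraph.isBridge_iff, not_not] at h1
    obtain ⟨p⟩ := h1
    obtain ⟨y, hy, h2, h3⟩ := reach_neighbour p hx
    rw [SimpleGraph.deleteEdges_adj] at h2
    refine ⟨y, hy, ?_, h2.1, h3.mono ?_⟩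
    · rintro rfl
      exact h2.2 Sym2.eq_swap
    · intro a b hab
      exact SimpleGraph.deleteEdges_le (G := K) _ (SimpleGraph.comap_adj.1 hab)
  have step3 : ∀ (x y : V) (hx : x ≠ v) (hy : y ≠ v), K.Adj v x → K.Adj v y →
      D.Reachable ⟨x, hx⟩ ⟨y, hy⟩ := by
    intro x y hx hy hvx hvy
    by_contra hn
    obtain ⟨x', hx', hne, hvx', hr⟩ := step2 x hx hvx
    obtain ⟨y', hy', hne', hvy', hr'⟩ := step2 y hy hvy
    have n1 : x ≠ y := by rintro rfl; exact hn (SimpleGraph.Reachable.refl _)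
    have n2 : x' ≠ y := by rintro rfl; exact hn hr
    have n3 : x ≠ y' := by rintro rfl; exact hn hr'.symm
    have n4 : x' ≠ y' := by rintro rfl; exact hn (hr.trans hr'.symm)
    have hsub : ({x, x', y, y'} : Set V) ⊆ K.neighborSet v := by
      rintro z (rfl | rfl | rfl | rfl) <;> assumption
    have h4 : ({x, x', y, y'} : Set V).ncard = 4 := by
      rw [Set.ncard_insert_of_notMem, Set.ncard_insert_of_notMem, Set.ncard_pair hne'.symm]
      · simp [n2, n4]
      · simp [hne.symm, n1, n3]
    have := (Set.ncard_le_ncard hsub).trans (hs v)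
    omega
  rintro ⟨a, ha⟩ ⟨b, hb⟩
  obtain ⟨p⟩ := hK.preconnected a v
  obtain ⟨q⟩ := hK.preconnected b v
  obtain ⟨x, hx, h1, h2⟩ := reach_neighbour p ha
  obtain ⟨y, hy, h3, h4⟩ := reach_neighbour q hb
  exact (h2.trans (step3 x y hx hy h1 h3)).trans h4.symm

lemma core_bridgeless {V : Type} {G : SimpleGraph V} {a b : V} (h : (core G).Adj a b) :
    ¬ (core G).IsBridge s(a, b) := by
  have h1 := (core_adj.1 h).2
  rw [SimpleGraph.isBridge_iff_forall_cycle_notMem (core_le G h)] at h1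
  rw [SimpleGraph.isBridge_iff_forall_cycle_notMem h]
  push Not at h1 ⊢
  obtain ⟨u, p, hp, he⟩ := h1
  have hall : ∀ e ∈ p.edges, e ∈ (core G).edgeSet := by
    intro e hep
    have hb : ¬ G.IsBridge e := fun hb => hb.notMem_edges_of_isCycle hp hep
    have hG := p.edges_subset_edgeSet hep
    induction e with
    | h c d => exact core_adj.2 ⟨hG, hb⟩
  exact ⟨u, p.transfer _ hall, hp.transfer hall, by rwa [SimpleGraph.Walk.edges_transfer]⟩

lemma reachable_induce {V : Type} {L : SimpleGraph V} {C : Set V}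
    (hC : ∀ a b, L.Adj a b → a ∈ C → b ∈ C) {a b : V} (p : L.Walk a b) (ha : a ∈ C) :
    ∃ hb : b ∈ C, (L.induce C).Reachable ⟨a, ha⟩ ⟨b, hb⟩ := by
  induction p with
  | nil => exact ⟨ha, SimpleGraph.Reachable.refl _⟩
  | @cons a c b h p ih =>
    obtain ⟨hb, hr⟩ := ih (hC _ _ h ha)
    have h3 : (L.induce C).Adj ⟨a, ha⟩ ⟨c, hC _ _ h ha⟩ := h
    exact ⟨hb, h3.reachable.trans hr⟩

lemma good_component {V : Type} [Finite V] {G : SimpleGraph V} (hs : Subcubic G)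
    (c : (core G).ConnectedComponent) : Good G c.supp := by
  have hclosed : ∀ a b, (core G).Adj a b → a ∈ c.supp → b ∈ c.supp := by
    intro a b hab ha
    have ha : (core G).connectedComponentMk a = c := ha
    change (core G).connectedComponentMk b = c
    rw [← ha]
    exact SimpleGraph.ConnectedComponent.sound hab.symm.reachable
  have hconn : (G.induce c.supp).Connected := by
    rw [← induce_core]
    induction c using SimpleGraph.ConnectedComponent.ind with | h v => ?_
    rw [SimpleGraph.connected_iff_exists_forall_reachable]
    refine ⟨⟨v, rfl⟩, ?_⟩
    rintro ⟨w, hw⟩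
    obtain ⟨p⟩ : (core G).Reachable v w := (SimpleGraph.ConnectedComponent.exact hw).symm
    exact (reachable_induce hclosed p rfl).2
  refine ⟨hconn, bridgeless hconn (hs.induce _) ?_⟩
  rintro ⟨a, ha⟩ ⟨b, hb⟩ hab
  rw [← induce_core] at hab ⊢
  have hab' : (core G).Adj a b := hab
  have h1 := core_bridgeless hab'
  rw [SimpleGraph.isBridge_iff, not_not] at h1 ⊢
  obtain ⟨p⟩ := h1
  obtain ⟨_, hr⟩ := reachable_induce
    (fun x y hxy hx => hclosed x y (SimpleGraph.deleteEdges_le _ hxy) hx) p ha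
  refine hr.mono ?_
  intro x y hxy
  rw [SimpleGraph.comap_adj, SimpleGraph.deleteEdges_adj] at hxy
  rw [SimpleGraph.deleteEdges_adj]
  refine ⟨hxy.1, fun h => hxy.2 ?_⟩
  rw [Set.mem_singleton_iff] at h ⊢
  have := congrArg (Sym2.map Subtype.val) h
  simpa using this

lemma good_cases {V : Type} [Finite V] {G : SimpleGraph V} {B : Set V} (hB : Good G B) :
    (∃ x y, G.Adj x y ∧ G.IsBridge s(x, y) ∧ B = {x, y}) ∨
      ∃ c : (core G).ConnectedComponent, B ⊆ c.supp := by
  by_cases h : ∃ x y, x ∈ B ∧ y ∈ B ∧ G.Adj x y ∧ G.IsBridge s(x, y)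
  · obtain ⟨x, y, hx, hy, h1, h2⟩ := h
    exact Or.inl ⟨x, y, h1, h2, good_bridge hB hx hy h2⟩
  · push Not at h
    right
    obtain ⟨⟨a, ha⟩⟩ := hB.1.nonempty
    refine ⟨(core G).connectedComponentMk a, fun b hb => ?_⟩
    have h1 := hB.1.preconnected ⟨b, hb⟩ ⟨a, ha⟩
    let f : G.induce B →g core G :=
      { toFun := fun a => a.1
        map_rel' := by
          intro a b hab
          exact core_adj.2 ⟨hab, h _ _ a.2 b.2 hab⟩ }
    exact SimpleGraph.ConnectedComponent.sound (h1.map f)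

lemma isBlock_iff {V : Type} [Finite V] [Nontrivial V] {G : SimpleGraph V} (hG : G.Connected)
    (hs : Subcubic G) (B : Set V) :
    IsBlock G B ↔ (∃ x y, G.Adj x y ∧ G.IsBridge s(x, y) ∧ B = {x, y}) ∨
      ∃ c : (core G).ConnectedComponent, c.supp.Nontrivial ∧ B = c.supp := by
  constructor
  · rintro ⟨hB, hmax⟩
    rcases good_cases hB with h | ⟨c, hc⟩
    · exact Or.inl h
    · right
      have h1 := hmax c.supp hc (good_component hs c)
      refine ⟨c, ?_, h1.symm⟩
      by_contra hn
      rw [Set.not_nontrivial_iff] at hn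
      obtain ⟨⟨a, ha⟩⟩ := hB.1.nonempty
      obtain ⟨b, hab⟩ : ∃ b, G.Adj a b := by
        obtain ⟨w, hw⟩ := exists_ne a
        obtain ⟨b, hb⟩ := (hG.preconnected a w).nonempty_neighborSet_left hw.symm
        exact ⟨b, hb⟩
      have h2 := hmax {a, b} (fun z hz => Or.inl (hn (hc hz) (hc ha))) (good_pair hab)
      have h3 : b ∈ B := by rw [← h2]; simp
      exact hab.ne (hn (hc ha) (hc h3))
  · rintro (⟨x, y, h1, h2, rfl⟩ | ⟨c, hc, rfl⟩)
    · exact ⟨good_pair h1, fun B' hB' hg =>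
        good_bridge hg (hB' (by simp)) (hB' (by simp)) h2⟩
    · refine ⟨good_component hs c, fun B' hB' hg => ?_⟩
      rcases good_cases hg with ⟨x, y, h1, h2, rfl⟩ | ⟨d, hd⟩
      · exfalso
        obtain ⟨a, ha, b, hb, hab⟩ := hc
        have hr : (core G).Reachable a b := SimpleGraph.ConnectedComponent.exact (ha.trans hb.symm)
        have ha' := hB' ha
        have hb' := hB' hb
        simp only [Set.mem_insert_iff, Set.mem_singleton_iff] at ha' hb'
        rcases ha' with rfl | rfl <;> rcases hb' with rfl | rfl
        · exact hab rfl
        · exact not_reachable_core h2 hr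
        · exact not_reachable_core h2 hr.symm
        · exact hab rfl
      · obtain ⟨a, ha⟩ := hc.nonempty
        have h3 : (core G).connectedComponentMk a = d := hd (hB' ha)
        have h4 : (core G).connectedComponentMk a = c := ha
        have : d = c := h3.symm.trans h4
        subst this
        exact Set.Subset.antisymm hd hB'

/-! ### The value of `r_4` -/

open scoped Classical in
lemma rg_formula {V : Type} [Fintype V] [Nontrivial V] {G : SimpleGraph V} (hG : G.Connected)
    (hs : Subcubic G) :
    rg 4 G = ∑ c : (core G).ConnectedComponent, eps 4 (G.induce c.supp) -
      2 / 9 * ((Fintype.card (core G).ConnectedComponent : ℝ) - 1) := by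
  have hset : {B : Set V | IsBlock G B} = (fun e : Sym2 V => {v | v ∈ e}) '' bridges G ∪
      SimpleGraph.ConnectedComponent.supp ''
        {c : (core G).ConnectedComponent | c.supp.Nontrivial} := by
    ext B
    rw [Set.mem_ofPred_eq, isBlock_iff hG hs]
    constructor
    · rintro (⟨x, y, h1, h2, rfl⟩ | ⟨c, hc, rfl⟩)
      · refine Or.inl ⟨s(x, y), ⟨h1, h2⟩, ?_⟩
        ext v
        simp
      · exact Or.inr ⟨c, hc, rfl⟩
    · rintro (⟨e, ⟨h1, h2⟩, rfl⟩ | ⟨c, hc, rfl⟩)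
      · left
        induction e with
        | h x y =>
          refine ⟨x, y, h1, h2, ?_⟩
          ext v
          simp
      · exact Or.inr ⟨c, hc, rfl⟩
  have hdisj : Disjoint ((fun e : Sym2 V => {v | v ∈ e}) '' bridges G)
      (SimpleGraph.ConnectedComponent.supp ''
        {c : (core G).ConnectedComponent | c.supp.Nontrivial}) := by
    rw [Set.disjoint_left]
    rintro _ ⟨e, ⟨h1, h2⟩, rfl⟩ ⟨c, -, h⟩
    induction e with
    | h x y =>
      have hx : x ∈ c.supp := by rw [h]; simp
      have hy : y ∈ c.supp := by rw [h]; simp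
      exact not_reachable_core h2 (SimpleGraph.ConnectedComponent.exact (hx.trans hy.symm))
  have hinj : Set.InjOn (fun e : Sym2 V => {v | v ∈ e}) (bridges G) := by
    intro e _ e' _ h
    apply Sym2.ext
    intro v
    exact Set.ext_iff.1 h v
  have hsum1 : ∑ᶠ e ∈ bridges G, eps 4 (G.induce {v | v ∈ e}) = -(2 / 9) * (bridges G).ncard := by
    rw [finsum_mem_congr rfl (g := fun _ => (-(2 / 9) : ℝ))]
    · rw [finsum_mem_eq_finite_toFinset_sum _ (Set.toFinite _), Finset.sum_const,
        Set.ncard_eq_toFinset_card _ (Set.toFinite _), nsmul_eq_mul, mul_comm]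
    · intro e he
      obtain ⟨h1, -⟩ := he
      induction e with
      | h x y =>
        have hxy : G.Adj x y := h1
        have hset : {v | v ∈ s(x, y)} = ({x, y} : Set V) := by ext v; simp
        have hc : Nat.card ({x, y} : Set V) = 2 := Set.ncard_pair hxy.ne
        rw [hset]
        refine (eps_small _ (by omega)).1 ?_
        have e2 : ({x, y} : Set V) ≃ Fin 2 := Finite.equivFinOfCardEq hc
        refine ⟨⟨e2, ?_⟩⟩
        rintro ⟨a, ha⟩ ⟨b, hb⟩
        simp only [SimpleGraph.top_adj, ne_eq, EmbeddingLike.apply_eq_iff_eq, Subtype.mk.injEq,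
          SimpleGraph.comap_adj, Function.Embedding.subtype_apply]
        refine ⟨fun hne => ?_, fun h => h.ne⟩
        rcases ha with rfl | rfl <;> rcases hb with rfl | rfl
        · exact absurd rfl hne
        · exact hxy
        · exact hxy.symm
        · exact absurd rfl hne
  have hsum2 : ∑ᶠ c ∈ {c : (core G).ConnectedComponent | c.supp.Nontrivial},
      eps 4 (G.induce c.supp) = ∑ c : (core G).ConnectedComponent, eps 4 (G.induce c.supp) := by
    rw [← finsum_eq_sum_of_fintype]
    refine finsum_congr fun c => ?_
    by_cases hc : c.supp.Nontrivial
    · rw [finsum_eq_if]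
      simp [hc]
    · rw [finsum_eq_if]
      simp only [Set.mem_ofPred_eq, hc, if_false]
      rw [Set.not_nontrivial_iff] at hc
      have h1 : Nat.card c.supp = 1 := by
        rw [Nat.card_eq_one_iff_unique]
        refine ⟨⟨fun a b => Subtype.ext (hc a.2 b.2)⟩, ?_⟩
        obtain ⟨v, hv⟩ := c.nonempty_supp
        exact ⟨⟨v, hv⟩⟩
      exact ((eps_small _ (by omega)).2.1 h1).symm
  have hcard := card_cc_bridges G (bridges G) fun e he => he
  have h1 : Nat.card G.ConnectedComponent = 1 := by
    have := hG.nonempty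
    rw [Nat.card_eq_one_iff_unique]
    exact ⟨hG.preconnected.subsingleton_connectedComponent, inferInstance⟩
  have hcard' : (Fintype.card (core G).ConnectedComponent : ℝ) = 1 + (bridges G).ncard := by
    rw [← Nat.card_eq_fintype_card]
    change (Nat.card (G.deleteEdges (bridges G)).ConnectedComponent : ℝ) = _
    rw [hcard, h1]
    push_cast
    rfl
  rw [rg, hset, finsum_mem_union hdisj (Set.toFinite _) (Set.toFinite _),
    finsum_mem_image hinj,
    finsum_mem_image (SimpleGraph.ConnectedComponent.supp_injective.injOn), hsum1, hsum2, hcard']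
  ring

lemma twoDisjoint {V : Type} {G : SimpleGraph V} {C D : Set V} (hCD : Disjoint C D)
    (hC : HasTri (G.induce C)) (hD : HasTri (G.induce D)) : TwoDisjointCyclesLt G 4 := by
  have key : ∀ A : Set V, HasTri (G.induce A) → ∃ (u : V) (p : G.Walk u u), p.IsCycle ∧
      p.length < 4 ∧ ∀ x ∈ p.support, x ∈ A := by
    rintro A ⟨a, b, c, h1, h2, h3⟩
    have h1' : G.Adj a b := h1
    have h2' : G.Adj a c := h2
    have h3' : G.Adj b c := h3
    refine ⟨a, .cons h1' (.cons h3' (.cons h2'.symm .nil)), ?_, by simp, ?_⟩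
    · simp [SimpleGraph.Walk.isCycle_def, SimpleGraph.Walk.isTrail_def, h1'.ne, h2'.ne, h3'.ne,
        h1'.ne.symm, h2'.ne.symm]
    · intro x hx
      simp only [SimpleGraph.Walk.support_cons, SimpleGraph.Walk.support_nil, List.mem_cons,
        List.not_mem_nil, or_false] at hx
      rcases hx with rfl | rfl | rfl | rfl
      · exact a.2
      · exact b.2
      · exact c.2
      · exact a.2
  obtain ⟨u, p, hp, hl, hs⟩ := key C hC
  obtain ⟨v, q, hq, hl', hs'⟩ := key D hD
  exact ⟨u, v, p, q, hp, hq, hl, hl', fun x hx hx' =>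
    Set.disjoint_left.1 hCD (hs x hx) (hs' x hx')⟩

lemma iso_of_eq_univ {V : Type} (G : SimpleGraph V) {C : Set V} (h : C = Set.univ) :
    Nonempty (G ≃g G.induce C) := by
  subst h
  exact ⟨(SimpleGraph.induceUnivIso G).symm⟩

lemma cubic_component {V : Type} [Finite V] {G : SimpleGraph V} (hG : G.Connected)
    (hs : Subcubic G) {C : Set V} (hne : C.Nonempty) (hC : Cubic (G.induce C)) :
    C = Set.univ := by
  have hclosed : ∀ a b, G.Adj a b → a ∈ C → b ∈ C := by
    intro a b hab ha
    have h1 := hC ⟨a, ha⟩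
    rw [ncard_neighborSet_induce] at h1
    have h2 := Set.eq_of_subset_of_ncard_le (Set.inter_subset_left : G.neighborSet a ∩ C ⊆ _)
      (by rw [h1]; exact hs a)
    have : b ∈ G.neighborSet a := hab
    rw [← h2] at this
    exact this.2
  obtain ⟨a, ha⟩ := hne
  refine Set.eq_univ_of_forall fun b => ?_
  obtain ⟨p⟩ := hG.preconnected a b
  exact (reachable_induce hclosed p ha).1

lemma addCutEdges_core {V : Type} (G : SimpleGraph V) : AddCutEdges (core G) G := by
  refine ⟨core_le G, ?_⟩
  rintro e ⟨h1, h2⟩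
  induction e with
  | h a b =>
    by_contra hb
    exact h2 (core_adj.2 ⟨h1, hb⟩)

lemma partition_core {V κ : Type} (G : SimpleGraph V) (e : κ ≃ (core G).ConnectedComponent) :
    ∃ P : V → κ, PartitionedBy (core G) P ∧ ∀ k, P ⁻¹' {k} = (e k).supp := by
  refine ⟨fun v => e.symm ((core G).connectedComponentMk v), ?_, ?_⟩
  · intro u v huv
    exact congrArg e.symm (SimpleGraph.ConnectedComponent.sound huv.reachable)
  · intro k
    ext v
    simp [Equiv.symm_apply_eq]

lemma sum_neg_one {κ : Type} [Fintype κ] {w : κ → ℤ} (hw : ∀ k, w k ≤ 0)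
    (hsum : ∑ k, w k = -1) : ∃ k, w k = -1 ∧ ∀ j, j ≠ k → w j = 0 := by
  classical
  obtain ⟨k, hk⟩ : ∃ k, w k ≠ 0 := by
    by_contra hn
    push Not at hn
    simp [hn] at hsum
  rw [Fintype.sum_eq_add_sum_subtype_ne w k] at hsum
  have h1 : ∑ i : {i // i ≠ k}, w i ≤ 0 := Finset.sum_nonpos fun i _ => hw i
  have h2 := hw k
  have h3 : ∑ i : {i // i ≠ k}, w i = 0 := by omega
  refine ⟨k, by omega, fun j hj => ?_⟩
  exact (Finset.sum_eq_zero_iff_of_nonpos fun (i : {i // i ≠ k}) _ => hw i).1 h3 ⟨j, hj⟩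
    (Finset.mem_univ _)

lemma sum_zero {κ : Type} [Fintype κ] {w : κ → ℤ} (hw : ∀ k, w k ≤ 0)
    (hsum : ∑ k, w k = 0) (k : κ) : w k = 0 :=
  (Finset.sum_eq_zero_iff_of_nonpos fun i _ => hw i).1 hsum k (Finset.mem_univ _)

/-- the value of `r_4` on connected subcubic graphs with no two
vertex-disjoint triangles. -/
theorem statement13 {V : Type} [Fintype V] (G : SimpleGraph V)
    (hconn : G.Connected) (hsub : Subcubic G) (h : ¬ TwoDisjointCyclesLt G 4) :
    -- (1)
    (Nonempty (G ≃g cyc 3) ∨ Nonempty (G ≃g (⊤ : SimpleGraph (Fin 4))) ∨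
      Nonempty (G ≃g K4plus) ∨ MemF 2 2 G) ∨
    -- (2)
    (rg 4 G = 4 / 9 ∧ ∃ (ι : Type) (P : V → Option ι) (H : SimpleGraph V),
        Nonempty ι ∧ AddCutEdges H G ∧ PartitionedBy H P ∧
        Nonempty ((H.induce (P ⁻¹' {none})) ≃g K4plus) ∧
        ∀ i : ι, Nonempty ((H.induce (P ⁻¹' {some i})) ≃g Lgraph)) ∨
    -- (3)
    (rg 4 G = 1 / 3 ∧
      ((∃ (ι : Type) (P : V → Option (Option ι)) (H : SimpleGraph V),
          AddCutEdges H G ∧ PartitionedBy H P ∧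
          Nonempty ((H.induce (P ⁻¹' {none})) ≃g K4plus) ∧
          (MemF 3 2 (H.induce (P ⁻¹' {some none})) ∨
            MemF 4 0 (H.induce (P ⁻¹' {some none}))) ∧
          ∀ i : ι, Nonempty ((H.induce (P ⁻¹' {some (some i)})) ≃g Lgraph)) ∨
       (∃ (ι : Type) (P : V → Option ι) (H : SimpleGraph V),
          Nonempty ι ∧ AddCutEdges H G ∧ PartitionedBy H P ∧
          Nonempty ((H.induce (P ⁻¹' {none})) ≃g cyc 3) ∧
          ∀ i : ι, Nonempty ((H.induce (P ⁻¹' {some i})) ≃g Lgraph)))) ∨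
    -- (4)
    (rg 4 G = 2 / 9 ∧
      ((∃ B : Set V, IsBlock G B ∧
          (Nonempty ((G.induce B) ≃g K4plus) ∨ Nonempty ((G.induce B) ≃g cyc 3))) ∨
       (∃ (ι : Type) (P : V → ι) (H : SimpleGraph V),
          AddCutEdges H G ∧ PartitionedBy H P ∧
          ∀ i : ι, MemF 3 1 (H.induce (P ⁻¹' {i}))))) ∨
    -- (5)
    (rg 4 G = 1 / 9 ∧
      ((∃ B : Set V, IsBlock G B ∧
          (Nonempty ((G.induce B) ≃g K4plus) ∨ Nonempty ((G.induce B) ≃g cyc 3))) ∨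
       (∃ (ι : Type) (P : V → Option ι) (H : SimpleGraph V),
          AddCutEdges H G ∧ PartitionedBy H P ∧
          (MemF 3 2 (H.induce (P ⁻¹' {none})) ∨ MemF 4 0 (H.induce (P ⁻¹' {none})) ∨
            ∃ k : ℕ, 1 ≤ k ∧ MemFG 4 3 0 k (H.induce (P ⁻¹' {none}))) ∧
          ∀ i : ι, MemF 3 1 (H.induce (P ⁻¹' {some i}))))) ∨
    -- (6)
    rg 4 G ≤ 0 := by
  classical
  rcases subsingleton_or_nontrivial V with hV | hV
  · -- a single vertex
    right; right; right; right; right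
    refine finsum_mem_induction (fun x : ℝ => x ≤ 0) le_rfl (fun _ _ hx hy => add_nonpos hx hy) ?_
    intro B _
    refine (eps_small _ ?_).2.2
    have : Nat.card B ≤ 1 := Finite.card_le_one_iff_subsingleton.2 inferInstance
    omega
  choose m hm hcases using fun c : (core G).ConnectedComponent => eps_cases (G.induce c.supp)
  have hrg : rg 4 G = ((2 + ∑ c, (m c - 2) : ℤ) : ℝ) / 9 := by
    rw [rg_formula hconn hsub, Finset.sum_congr rfl fun c _ => hm c, ← Finset.sum_div]
    push_cast
    rw [Finset.sum_sub_distrib, Finset.sum_const, Finset.card_univ, nsmul_eq_mul]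
    ring
  -- the cubic components
  by_cases hcub : ∃ c : (core G).ConnectedComponent,
      MemF 1 1 (G.induce c.supp) ∨ MemF 2 2 (G.induce c.supp)
  · obtain ⟨c, hc⟩ := hcub
    have hcount : 2 * (G.induce c.supp).edgeSet.ncard = 3 * Nat.card c.supp := by
      rcases hc with hc | hc <;> · have := hc.counts; omega
    have huniv := cubic_component hconn hsub c.nonempty_supp ((hsub.induce _).cubic hcount)
    obtain ⟨f⟩ := iso_of_eq_univ G huniv
    left
    rcases hc with hc | hc
    · exact Or.inr (Or.inl (hc.of_iso f).one_one)
    · exact Or.inr (Or.inr (Or.inr (hc.of_iso f)))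
  push Not at hcub
  have hcases' : ∀ c : (core G).ConnectedComponent,
      (m c = 4 ∧ MemF 2 1 (G.induce c.supp)) ∨ (m c = 3 ∧ MemF 3 0 (G.induce c.supp)) ∨
      (m c = 2 ∧ MemF 3 1 (G.induce c.supp)) ∨
      (m c = 1 ∧ (MemF 3 2 (G.induce c.supp) ∨ MemF 4 0 (G.induce c.supp) ∨
        ∃ k, 1 ≤ k ∧ MemFG 4 3 0 k (G.induce c.supp))) ∨ m c ≤ 0 := by
    intro c
    obtain ⟨n1, n2⟩ := hcub c
    rcases hcases c with ⟨_, h⟩ | h | ⟨h0, h | h⟩ | h | h | h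
    · exact absurd h n1
    · exact Or.inl h
    · exact Or.inr (Or.inl ⟨h0, h⟩)
    · exact absurd h n2
    · exact Or.inr (Or.inr (Or.inl h))
    · exact Or.inr (Or.inr (Or.inr (Or.inl h)))
    · exact Or.inr (Or.inr (Or.inr (Or.inr h)))
  by_cases hbig : ∃ c, 3 ≤ m c
  · obtain ⟨c₀, hc₀⟩ := hbig
    have h₀ : (m c₀ = 4 ∧ MemF 2 1 (G.induce c₀.supp)) ∨
        (m c₀ = 3 ∧ MemF 3 0 (G.induce c₀.supp)) := by
      rcases hcases' c₀ with h | h | h | h | h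
      · exact Or.inl h
      · exact Or.inr h
      all_goals omega
    have htri₀ : HasTri (G.induce c₀.supp) := by
      rcases h₀ with ⟨-, h⟩ | ⟨-, h⟩
      · obtain ⟨f⟩ := h.two_one
        exact hasTri_K4plus.of_iso f
      · obtain ⟨f⟩ := h.three_zero
        exact hasTri_cyc3.of_iso f
    have hnt : c₀.supp.Nontrivial := by
      rw [← Set.nontrivial_coe_sort, ← Finite.one_lt_card_iff_nontrivial]
      rcases h₀ with ⟨-, h⟩ | ⟨-, h⟩ <;> · have := h.counts; omega
    have hblock : ∃ B : Set V, IsBlock G B ∧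
        (Nonempty ((G.induce B) ≃g K4plus) ∨ Nonempty ((G.induce B) ≃g cyc 3)) := by
      refine ⟨c₀.supp, (isBlock_iff hconn hsub _).2 (Or.inr ⟨c₀, hnt, rfl⟩), ?_⟩
      rcases h₀ with ⟨-, h⟩ | ⟨-, h⟩
      · exact Or.inl h.two_one
      · exact Or.inr h.three_zero
    have hno : ∀ d : {d // d ≠ c₀}, ¬ HasTri (G.induce d.1.supp) := by
      intro d hd
      refine h (twoDisjoint ?_ htri₀ hd)
      rw [Set.disjoint_left]
      intro v hv hv'
      have hv : (core G).connectedComponentMk v = c₀ := hv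
      have hv' : (core G).connectedComponentMk v = d.1 := hv'
      exact d.2 (hv'.symm.trans hv)
    have hd : ∀ d : {d // d ≠ c₀},
        (m d.1 = 2 ∧ Nonempty (G.induce d.1.supp ≃g Lgraph)) ∨
        (m d.1 = 1 ∧ (MemF 3 2 (G.induce d.1.supp) ∨ MemF 4 0 (G.induce d.1.supp))) ∨
        m d.1 ≤ 0 := by
      intro d
      rcases hcases' d.1 with ⟨-, h1⟩ | ⟨-, h1⟩ | ⟨h0, h1⟩ | ⟨h0, h1 | h1 | ⟨k, -, h1⟩⟩ | h1
      · obtain ⟨f⟩ := h1.two_one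
        exact absurd (hasTri_K4plus.of_iso f) (hno d)
      · obtain ⟨f⟩ := h1.three_zero
        exact absurd (hasTri_cyc3.of_iso f) (hno d)
      · rcases h1.three_one with h2 | h2
        · exact Or.inl ⟨h0, h2⟩
        · exact absurd h2 (hno d)
      · exact Or.inr (Or.inl ⟨h0, Or.inl h1⟩)
      · exact Or.inr (Or.inl ⟨h0, Or.inr h1⟩)
      · exact absurd h1.hasTri (hno d)
      · exact Or.inr (Or.inr h1)
    have hw : ∀ d : {d // d ≠ c₀}, m d.1 - 2 ≤ 0 := by
      intro d
      rcases hd d with h1 | h1 | h1 <;> omega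
    have hS : ∑ d : {d // d ≠ c₀}, (m d.1 - 2) ≤ 0 := Finset.sum_nonpos fun d _ => hw d
    rw [Fintype.sum_eq_add_sum_subtype_ne (fun c => m c - 2) c₀] at hrg
    have hzero : ∑ d : {d // d ≠ c₀}, (m d.1 - 2) = 0 →
        ∀ d : {d // d ≠ c₀}, Nonempty (G.induce d.1.supp ≃g Lgraph) := by
      intro h0 d
      have h1 := sum_zero hw h0 d
      rcases hd d with h2 | h2 | h2
      · exact h2.2
      all_goals omega
    have hempty : ¬ Nonempty {d // d ≠ c₀} → Nonempty (G ≃g G.induce c₀.supp) := by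
      intro hE
      refine iso_of_eq_univ G (Set.eq_univ_of_forall fun v => ?_)
      by_contra hv
      exact hE ⟨⟨(core G).connectedComponentMk v, hv⟩⟩
    generalize hSdef : ∑ d : {d // d ≠ c₀}, (m d.1 - 2) = S at hS hrg hzero
    rcases h₀ with ⟨hm₀, hF⟩ | ⟨hm₀, hF⟩
    · rw [hm₀] at hrg
      by_cases s0 : S = 0
      · by_cases hE : Nonempty {d // d ≠ c₀}
        · right; left
          refine ⟨by rw [hrg, s0]; norm_num, ?_⟩
          obtain ⟨P, hP, hPk⟩ := partition_core G (Equiv.optionSubtypeNe c₀)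
          refine ⟨_, P, core G, hE, addCutEdges_core G, hP, ?_, ?_⟩
          · rw [hPk, Equiv.optionSubtypeNe_none, induce_core]
            exact hF.two_one
          · intro i
            rw [hPk, Equiv.optionSubtypeNe_some, induce_core]
            exact hzero s0 i
        · obtain ⟨f⟩ := hempty hE
          exact Or.inl (Or.inr (Or.inr (Or.inl (hF.of_iso f).two_one)))
      by_cases s1 : S = -1
      · right; right; left
        refine ⟨by rw [hrg, s1]; norm_num, Or.inl ?_⟩
        obtain ⟨d, hd1, hd2⟩ := sum_neg_one hw (hSdef.trans s1)
        obtain ⟨P, hP, hPk⟩ := partition_core G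
          ((Equiv.optionCongr (Equiv.optionSubtypeNe d)).trans (Equiv.optionSubtypeNe c₀))
        refine ⟨_, P, core G, addCutEdges_core G, hP, ?_, ?_, ?_⟩
        · rw [hPk, induce_core]
          exact hF.two_one
        · have : ((Equiv.optionCongr (Equiv.optionSubtypeNe d)).trans
              (Equiv.optionSubtypeNe c₀)) (some none) = d.1 := by simp
          rw [hPk, this, induce_core]
          rcases hd d with h2 | h2 | h2
          · omega
          · exact h2.2
          · omega
        · intro i
          have : ((Equiv.optionCongr (Equiv.optionSubtypeNe d)).trans
              (Equiv.optionSubtypeNe c₀)) (some (some i)) = i.1.1 := by simp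
          rw [hPk, this, induce_core]
          have h1 := hd2 i.1 i.2
          rcases hd i.1 with h2 | h2 | h2
          · exact h2.2
          all_goals omega
      by_cases s2 : S = -2
      · right; right; right; left
        exact ⟨by rw [hrg, s2]; norm_num, Or.inl hblock⟩
      by_cases s3 : S = -3
      · right; right; right; right; left
        exact ⟨by rw [hrg, s3]; norm_num, Or.inl hblock⟩
      · right; right; right; right; right
        rw [hrg]
        have h5 : S ≤ -4 := by omega
        have h6 : (S : ℝ) ≤ -4 := by exact_mod_cast h5
        push_cast
        linarith
    · rw [hm₀] at hrg
      by_cases s0 : S = 0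
      · by_cases hE : Nonempty {d // d ≠ c₀}
        · right; right; left
          refine ⟨by rw [hrg, s0]; norm_num, Or.inr ?_⟩
          obtain ⟨P, hP, hPk⟩ := partition_core G (Equiv.optionSubtypeNe c₀)
          refine ⟨_, P, core G, hE, addCutEdges_core G, hP, ?_, ?_⟩
          · rw [hPk, Equiv.optionSubtypeNe_none, induce_core]
            exact hF.three_zero
          · intro i
            rw [hPk, Equiv.optionSubtypeNe_some, induce_core]
            exact hzero s0 i
        · obtain ⟨f⟩ := hempty hE
          exact Or.inl (Or.inl (hF.of_iso f).three_zero)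
      by_cases s2 : S = -1
      · right; right; right; left
        exact ⟨by rw [hrg, s2]; norm_num, Or.inl hblock⟩
      by_cases s3 : S = -2
      · right; right; right; right; left
        exact ⟨by rw [hrg, s3]; norm_num, Or.inl hblock⟩
      · right; right; right; right; right
        rw [hrg]
        have h5 : S ≤ -3 := by omega
        have h6 : (S : ℝ) ≤ -3 := by exact_mod_cast h5
        push_cast
        linarith
  · push Not at hbig
    have hw : ∀ c, m c - 2 ≤ 0 := fun c => by have := hbig c; omega
    have hS : ∑ c, (m c - 2) ≤ 0 := Finset.sum_nonpos fun c _ => hw c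
    generalize hSdef : ∑ c, (m c - 2) = S at hS hrg
    have htwo : ∀ c, m c - 2 = 0 → MemF 3 1 (G.induce c.supp) := by
      intro c hc
      rcases hcases' c with h1 | h1 | h1 | h1 | h1
      · omega
      · omega
      · exact h1.2
      · omega
      · omega
    by_cases s0 : S = 0
    · right; right; right; left
      refine ⟨by rw [hrg, s0]; norm_num, Or.inr ?_⟩
      obtain ⟨P, hP, hPk⟩ := partition_core G (Equiv.refl _)
      refine ⟨_, P, core G, addCutEdges_core G, hP, fun i => ?_⟩
      rw [hPk, Equiv.refl_apply, induce_core]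
      exact htwo i (sum_zero hw (hSdef.trans s0) i)
    by_cases s1 : S = -1
    · right; right; right; right; left
      refine ⟨by rw [hrg, s1]; norm_num, Or.inr ?_⟩
      obtain ⟨d, hd1, hd2⟩ := sum_neg_one hw (hSdef.trans s1)
      obtain ⟨P, hP, hPk⟩ := partition_core G (Equiv.optionSubtypeNe d)
      refine ⟨_, P, core G, addCutEdges_core G, hP, ?_, ?_⟩
      · rw [hPk, Equiv.optionSubtypeNe_none, induce_core]
        rcases hcases' d with h1 | h1 | h1 | h1 | h1
        · omega
        · omega
        · omega
        · exact h1.2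
        · omega
      · intro i
        rw [hPk, Equiv.optionSubtypeNe_some, induce_core]
        exact htwo i.1 (hd2 i.1 i.2)
    · right; right; right; right; right
      rw [hrg]
      have : ((2 + S : ℤ) : ℝ) ≤ 0 := by exact_mod_cast (by omega)
      linarith

end InducedForest
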